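/- arXiv:2406.16656 — 5 statements merged into one kernel-verified Lean document; each statement's English description precedes it below -/
import Mathlib

section
/- For all integers n > t ≥ 1, the maximum size M(n,t) of a subset C of the symmetric group S_n whose distinct elements have pairwise Ulam distance greater than t satisfies M(n,t) ≥ n! / (binom(n,t)^2 · t!). -/
open scoped Classical

/-- A translocation: move the symbol at (0-indexed) position `i` to position `j`,
shifting intermediate symbols by one position. -/
def translocate {α : Type*} (l : List α) (i j : ℕ) : List α :=
  match l[i]? with
  | some a => (l.eraseIdx i).insertIdx j a
  | none => l

/-- The Ulam distance between two sequences: the minimum number of translocations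
needed to transform `x` into `y`. -/
noncomputable def ulamDist {α : Type*} (x y : List α) : ℕ :=
  sInf {m | ∃ g : ℕ → List α, g 0 = x ∧ g m = y ∧
    ∀ k < m, ∃ i j, i < (g k).length ∧ j < (g k).length ∧ i ≠ j ∧
      g (k+1) = translocate (g k) i j}

/-- The sequence form of a permutation of `{1,...,n}` (values written `1`-indexed). -/
def seqOf {n : ℕ} (π : Equiv.Perm (Fin n)) : List ℕ :=
  List.ofFn fun i => (π i : ℕ) + 1

/-- The Ulam distance between two permutations. -/
noncomputable def dU {n : ℕ} (π σ : Equiv.Perm (Fin n)) : ℕ :=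
  ulamDist (seqOf π) (seqOf σ)

/-- Length of a longest common subsequence of two sequences. -/
noncomputable def lcsLen {α : Type*} (x y : List α) : ℕ :=
  sSup {k | ∃ z : List α, z.Sublist x ∧ z.Sublist y ∧ z.length = k}

/-- Levenshtein distance: minimum number of insertions and deletions needed to
transform `x` into `y`. -/
noncomputable def levDist {α : Type*} (x y : List α) : ℕ :=
  sInf {m | ∃ g : ℕ → List α, g 0 = x ∧ g m = y ∧
    ∀ k < m, (∃ i a, i ≤ (g k).length ∧ g (k+1) = (g k).insertIdx i a) ∨
      (∃ i, i < (g k).length ∧ g (k+1) = (g k).eraseIdx i)}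

/-- Hamming distance between two permutations: number of positions where they differ. -/
def dH {m : ℕ} (a b : Equiv.Perm (Fin m)) : ℕ :=
  (Finset.univ.filter fun i => a i ≠ b i).card

/-- `bar π` = the permutation `π` of `{1,...,n}` extended to `{1,...,n+1}` by
appending the symbol `n+1` at the end (i.e. fixing the last point). -/
def bar {n : ℕ} (π : Equiv.Perm (Fin n)) : Equiv.Perm (Fin (n+1)) :=
  (Equiv.permCongr finSuccEquivLast).symm π.optionCongr

/-- The map `f : S_n → S_{n+1}`: `fmap π` sends each symbol `i` to the symbol
that cyclically follows `i` in the sequence form of `bar π`, i.e.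
`f(π̄)_i = π̄_{π̄⁻¹(i)+1}` for `i ≤ n` and `f(π̄)_{n+1} = π̄_1`. -/
def fmap {n : ℕ} (π : Equiv.Perm (Fin n)) : Equiv.Perm (Fin (n+1)) :=
  bar π * finRotate (n+1) * (bar π)⁻¹

/-- The deletion ball `D_t(π)`: all sequences of length `n - t` obtained from `π`
by deleting `t` symbols, i.e. all subsequences of `π` of length `n - t`. -/
def Dball {n : ℕ} (t : ℕ) (π : Equiv.Perm (Fin n)) : Set (List ℕ) :=
  {s | s.Sublist (seqOf π) ∧ s.length = n - t}

/-- `Mnt n t`: the maximum size of a subset of `S_n` whose distinct elements have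
pairwise Ulam distance greater than `t`. -/
noncomputable def Mnt (n t : ℕ) : ℕ :=
  sSup {m | ∃ C : Finset (Equiv.Perm (Fin n)),
    (∀ π ∈ C, ∀ σ ∈ C, π ≠ σ → t < dU π σ) ∧ C.card = m}

/-- A single translocation step between sequences. -/
def TranslocationStep {α : Type*} (x y : List α) : Prop :=
  ∃ i j, i < x.length ∧ j < x.length ∧ i ≠ j ∧ y = translocate x i j

theorem TranslocationStep.cons {α : Type*} {x y : List α} (a : α)
    (h : TranslocationStep x y) : TranslocationStep (a :: x) (a :: y) := by
  obtain ⟨i, j, hi, hj, hij, rfl⟩ := h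
  refine ⟨i + 1, j + 1, by simpa using hi, by simpa using hj, by simpa using hij, ?_⟩
  simp [translocate, List.getElem?_eq_getElem hi]

theorem List.Perm.reflTransGen_translocationStep {α : Type*} {x y : List α} (h : x.Perm y) :
    Relation.ReflTransGen TranslocationStep x y := by
  induction h with
  | nil => exact .refl
  | cons a _ ih => exact ih.lift (a :: ·) fun _ _ => TranslocationStep.cons a
  | swap a b l => exact .single ⟨0, 1, by simp, by simp, by simp, by simp [translocate]⟩
  | trans _ _ ih₁ ih₂ => exact ih₁.trans ih₂

theorem exists_path_of_reflTransGen {α : Type*} {r : α → α → Prop} {x y : α}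
    (h : Relation.ReflTransGen r x y) :
    ∃ (m : ℕ) (g : ℕ → α), g 0 = x ∧ g m = y ∧ ∀ k < m, r (g k) (g (k + 1)) := by
  induction h using Relation.ReflTransGen.head_induction_on with
  | refl => exact ⟨0, fun _ => y, rfl, rfl, by simp⟩
  | @head a b hab _ ih =>
    obtain ⟨m, g, h0, hm, hg⟩ := ih
    refine ⟨m + 1, fun k => Nat.casesOn k a g, rfl, hm, ?_⟩
    rintro (_ | k) hk
    · simpa [h0] using hab
    · exact hg k (by omega)

theorem List.Perm.exists_translocation_path {α : Type*} {x y : List α} (h : x.Perm y) :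
    ∃ g : ℕ → List α, g 0 = x ∧ g (ulamDist x y) = y ∧
      ∀ k < ulamDist x y, TranslocationStep (g k) (g (k + 1)) := by
  obtain ⟨m, hm⟩ := exists_path_of_reflTransGen h.reflTransGen_translocationStep
  exact Nat.sInf_mem (s := {m | ∃ g : ℕ → List α, g 0 = x ∧ g m = y ∧
    ∀ k < m, TranslocationStep (g k) (g (k + 1))}) ⟨m, hm⟩

theorem List.Sublist.exists_sublist_eraseIdx {α : Type*} {z x : List α} (h : z.Sublist x) :
    ∀ i, ∃ w : List α, w.Sublist z ∧ w.Sublist (x.eraseIdx i) ∧ z.length ≤ w.length + 1 := by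
  induction h with
  | slnil => exact fun i => ⟨[], by simp⟩
  | @cons z x a h ih =>
    rintro (_ | i)
    · exact ⟨z, .refl z, h, by simp⟩
    · obtain ⟨w, hz, hx, hl⟩ := ih i
      exact ⟨w, hz, hx.cons a, hl⟩
  | @cons_cons z x a h ih =>
    rintro (_ | i)
    · exact ⟨z, z.sublist_cons_self a, h, by simp⟩
    · obtain ⟨w, hz, hx, hl⟩ := ih i
      exact ⟨a :: w, hz.cons_cons a, hx.cons_cons a, by simpa using hl⟩

theorem eraseIdx_sublist_translocate {α : Type*} {x : List α} {i : ℕ} (j : ℕ)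
    (hi : i < x.length) : (x.eraseIdx i).Sublist (translocate x i j) := by
  simp [translocate, List.getElem?_eq_getElem hi]

theorem exists_common_sublist_of_path {α : Type*} {g : ℕ → List α} {m : ℕ}
    (hg : ∀ k < m, TranslocationStep (g k) (g (k + 1))) :
    ∃ z : List α, z.Sublist (g 0) ∧ z.Sublist (g m) ∧ (g 0).length ≤ z.length + m := by
  induction m with
  | zero => exact ⟨g 0, .refl _, .refl _, by simp⟩
  | succ m ih =>
    obtain ⟨z, h0, hm, hl⟩ := ih fun k hk => hg k (by omega)
    obtain ⟨i, j, hi, -, -, hs⟩ := hg m (by omega)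
    obtain ⟨w, hwz, hwx, hw⟩ := hm.exists_sublist_eraseIdx i
    exact ⟨w, hwz.trans h0, hs ▸ hwx.trans (eraseIdx_sublist_translocate j hi), by omega⟩

theorem seqOf_perm {n : ℕ} (π σ : Equiv.Perm (Fin n)) : (seqOf π).Perm (seqOf σ) := by
  have h (π : Equiv.Perm (Fin n)) :
      (seqOf π).Perm (List.ofFn fun i : Fin n => (i : ℕ) + 1) :=
    Equiv.Perm.ofFn_comp_perm π fun i : Fin n => (i : ℕ) + 1
  exact (h π).trans (h σ).symm

/-- The permutations have a common subsequence of length `k`, given by its positions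
in the first permutation. -/
def HasCommonSubseq {n : ℕ} (k : ℕ) (π σ : Equiv.Perm (Fin n)) : Prop :=
  ∃ f : Fin k ↪o Fin n, StrictMono fun i => σ.symm (π (f i))

theorem HasCommonSubseq.symm {n k : ℕ} {π σ : Equiv.Perm (Fin n)}
    (h : HasCommonSubseq k π σ) : HasCommonSubseq k σ π := by
  obtain ⟨f, hf⟩ := h
  exact ⟨OrderEmbedding.ofStrictMono _ hf, by simpa using f.strictMono⟩

theorem HasCommonSubseq.refl {n k : ℕ} (hk : k ≤ n) (π : Equiv.Perm (Fin n)) :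
    HasCommonSubseq k π π :=
  ⟨Fin.castLEOrderEmb hk, by simpa using Fin.strictMono_castLE hk⟩

theorem List.Sublist.exists_positions_seqOf {n : ℕ} {z : List ℕ} {π : Equiv.Perm (Fin n)}
    (h : z.Sublist (seqOf π)) :
    ∃ f : Fin z.length ↪o Fin n, ∀ i, z.get i = (π (f i) : ℕ) + 1 := by
  obtain ⟨f, hf⟩ := List.sublist_iff_exists_fin_orderEmbedding_get_eq.1 h
  refine ⟨f.trans (Fin.castOrderIso (by simp [seqOf])).toOrderEmbedding, fun i => ?_⟩
  rw [hf]
  simp only [seqOf, List.get_ofFn]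
  rfl

theorem hasCommonSubseq_of_dU_le {n t : ℕ} {π σ : Equiv.Perm (Fin n)} (h : dU π σ ≤ t) :
    HasCommonSubseq (n - t) π σ := by
  obtain ⟨g, h0, hm, hg⟩ := (seqOf_perm π σ).exists_translocation_path
  obtain ⟨z, hz0, hzm, hl⟩ := exists_common_sublist_of_path hg
  rw [h0] at hz0 hl
  rw [hm] at hzm
  have hlen : n - t ≤ z.length := by
    have : (seqOf π).length = n := by simp [seqOf]
    unfold dU at h
    omega
  obtain ⟨f, hf⟩ := hz0.exists_positions_seqOf
  obtain ⟨g, hg⟩ := hzm.exists_positions_seqOf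
  refine ⟨(Fin.castLEOrderEmb hlen).trans f, ?_⟩
  have key (i) : σ.symm (π (f i)) = g i := by
    rw [Equiv.symm_apply_eq]
    have := (hf i).symm.trans (hg i)
    exact Fin.ext (by omega)
  simpa [key, Function.comp_def] using g.strictMono.comp (Fin.strictMono_castLE hlen)

theorem factorial_mul_card_strictMono_le {n k : ℕ} (e : Fin k ↪ Fin n) :
    k.factorial * (Finset.univ.filter fun σ : Equiv.Perm (Fin n) =>
      StrictMono fun i => σ.symm (e i)).card ≤ n.factorial := by
  have hk : k.factorial = (Finset.univ : Finset (Equiv.Perm (Fin k))).card := by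
    simp [Fintype.card_perm]
  have hn : n.factorial = (Finset.univ : Finset (Equiv.Perm (Fin n))).card := by
    simp [Fintype.card_perm]
  rw [hk, hn, ← Finset.card_product]
  refine Finset.card_le_card_of_injOn (fun p => p.1.viaEmbedding e * p.2) (by simp) ?_
  have mono (ρ : Equiv.Perm (Fin k)) (σ : Equiv.Perm (Fin n))
      (h : StrictMono fun i => σ.symm (e i)) :
      StrictMono fun i => (ρ.viaEmbedding e * σ).symm (e (ρ i)) := by
    have heq (i) : (ρ.viaEmbedding e * σ).symm (e (ρ i)) = σ.symm (e i) := by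
      rw [Equiv.symm_apply_eq]
      simp [Equiv.Perm.viaEmbedding_apply]
    simpa only [heq] using h
  rintro ⟨ρ₁, σ₁⟩ h₁ ⟨ρ₂, σ₂⟩ h₂ h
  simp only [Finset.coe_product, Set.mem_prod, Finset.mem_coe, Finset.mem_filter,
    Finset.mem_univ, true_and] at h₁ h₂ h
  have m₁ := mono ρ₁ σ₁ h₁
  have m₂ := mono ρ₂ σ₂ h₂
  rw [h] at m₁
  have hfun := (m₁.range_inj m₂).1 <| by
    have hr (ρ : Equiv.Perm (Fin k)) (u : Fin k → Fin n) :
        Set.range (fun i => u (ρ i)) = Set.range u := ρ.surjective.range_comp u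
    exact (hr ρ₁ fun i => (ρ₂.viaEmbedding e * σ₂).symm (e i)).trans (hr ρ₂ _).symm
  have hρ : ρ₁ = ρ₂ := Equiv.ext fun i => by simpa using congrFun hfun i
  subst hρ
  simpa using h

theorem card_orderEmbedding_fin_le (k n : ℕ) :
    Nat.card (Fin k ↪o Fin n) ≤ n.choose k := by
  have : n.choose k = Nat.card (Finset.powersetCard k (Finset.univ : Finset (Fin n))) := by
    simp
  rw [this]
  refine Nat.card_le_card_of_injective
    (fun f => ⟨Finset.univ.map f.toEmbedding, by simp [Finset.mem_powersetCard]⟩) ?_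
  intro f g h
  have h' := congrArg (fun s : Finset (Fin n) => (s : Set (Fin n))) (Subtype.ext_iff.1 h)
  exact OrderEmbedding.range_inj.1 (by simpa using h')

theorem card_hasCommonSubseq_le {n t : ℕ} (ht : t ≤ n) (π : Equiv.Perm (Fin n)) :
    (Finset.univ.filter (HasCommonSubseq (n - t) π)).card ≤
      n.choose t ^ 2 * t.factorial := by
  have hsub : Finset.univ.filter (HasCommonSubseq (n - t) π) ⊆
      (Finset.univ : Finset (Fin (n - t) ↪o Fin n)).biUnion fun f =>
        Finset.univ.filter fun σ => StrictMono fun i => σ.symm (π (f i)) := by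
    intro σ
    simp [HasCommonSubseq]
  calc _ ≤ _ := Finset.card_le_card hsub
    _ ≤ (Finset.univ : Finset (Fin (n - t) ↪o Fin n)).card * (n.choose t * t.factorial) := by
      refine Finset.card_biUnion_le_card_mul _ _ _ fun f _ => ?_
      have := factorial_mul_card_strictMono_le (f.toEmbedding.trans π.toEmbedding)
      rw [← Nat.choose_mul_factorial_mul_factorial ht, mul_comm] at this
      exact Nat.le_of_mul_le_mul_right this (Nat.factorial_pos _)
    _ ≤ n.choose t * (n.choose t * t.factorial) := by
      gcongr
      have := card_orderEmbedding_fin_le (n - t) n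
      rwa [Nat.choose_symm ht, Nat.card_eq_fintype_card] at this
    _ = _ := by ring

theorem factorial_le_Mnt_mul {n t : ℕ} (htn : t ≤ n) :
    n.factorial ≤ Mnt n t * (n.choose t ^ 2 * t.factorial) := by
  let S : Set ℕ := {m | ∃ C : Finset (Equiv.Perm (Fin n)),
    (∀ π ∈ C, ∀ σ ∈ C, π ≠ σ → t < dU π σ) ∧ C.card = m}
  have hbdd : BddAbove S := by
    refine ⟨Fintype.card (Equiv.Perm (Fin n)), ?_⟩
    rintro _ ⟨C, -, rfl⟩
    exact C.card_le_univ
  obtain ⟨C, hC, hcard⟩ : Mnt n t ∈ S := Nat.sSup_mem ⟨0, ∅, by simp, rfl⟩ hbdd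
  have hcover (σ : Equiv.Perm (Fin n)) : ∃ π ∈ C, HasCommonSubseq (n - t) π σ := by
    by_contra! hσ
    have hnot : σ ∉ C := fun h => hσ σ h (.refl (Nat.sub_le n t) σ)
    have hmem : (insert σ C).card ∈ S := by
      refine ⟨insert σ C, ?_, rfl⟩
      intro a ha b hb hab
      by_contra! hd
      have hs := hasCommonSubseq_of_dU_le hd
      rcases Finset.mem_insert.1 ha with rfl | ha' <;>
        rcases Finset.mem_insert.1 hb with rfl | hb'
      · exact hab rfl
      · exact hσ b hb' hs.symm
      · exact hσ a ha' hs
      · exact absurd (hC a ha' b hb' hab) (by omega)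
    have hle : (insert σ C).card ≤ Mnt n t := le_csSup hbdd hmem
    rw [Finset.card_insert_of_notMem hnot] at hle
    omega
  have huniv : (Finset.univ : Finset (Equiv.Perm (Fin n))) ⊆
      C.biUnion fun π => Finset.univ.filter (HasCommonSubseq (n - t) π) := by
    intro σ _
    simpa using hcover σ
  calc n.factorial = (Finset.univ : Finset (Equiv.Perm (Fin n))).card := by
        simp [Fintype.card_perm]
    _ ≤ _ := Finset.card_le_card huniv
    _ ≤ C.card * (n.choose t ^ 2 * t.factorial) :=
      Finset.card_biUnion_le_card_mul _ _ _ fun π _ => card_hasCommonSubseq_le htn π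
    _ = _ := by rw [hcard]

/-- GV lower bound: for all integers `n > t ≥ 1`,
`M(n,t) ≥ n! / (C(n,t)² · t!)`. -/
theorem stmt0 (n t : ℕ) (ht : 1 ≤ t) (htn : t < n) :
    (n.factorial : ℝ) / ((n.choose t : ℝ) ^ 2 * (t.factorial : ℝ)) ≤ (Mnt n t : ℝ) := by
  have hc : 0 < n.choose t := Nat.choose_pos htn.le
  have hf : 0 < t.factorial := t.factorial_pos
  rw [div_le_iff₀ (by positivity)]
  exact_mod_cast factorial_le_Mnt_mul htn.le
end

section
/- For all integers n > t ≥ 1, the maximum size M(n,t) of a subset C of the symmetric group S_n whose distinct elements have pairwise Ulam distance greater than t satisfies M(n,t) · binom(n,t) ≤ n!/t!; equivalently M(n,t) ≤ (n−t)!. -/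
open scoped Classical

/-- The list `x` can be transformed into `y` by `m` proper translocations. -/
def TranslocReach {α : Type*} (m : ℕ) (x y : List α) : Prop :=
  ∃ g : ℕ → List α, g 0 = x ∧ g m = y ∧
    ∀ k < m, ∃ i j, i < (g k).length ∧ j < (g k).length ∧ i ≠ j ∧
      g (k+1) = translocate (g k) i j

theorem TranslocReach.refl {α : Type*} (x : List α) : TranslocReach 0 x x :=
  ⟨fun _ => x, rfl, rfl, fun k hk => absurd hk (Nat.not_lt_zero k)⟩

theorem TranslocReach.cons {α : Type*} {m : ℕ} {x y : List α} {i j : ℕ}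
    (hi : i < x.length) (hj : j < x.length) (hij : i ≠ j)
    (h : TranslocReach m (translocate x i j) y) : TranslocReach (m + 1) x y := by
  obtain ⟨g, h0, hm, hg⟩ := h
  refine ⟨fun k => Nat.casesOn k x g, rfl, hm, fun k hk => ?_⟩
  cases k with
  | zero => exact ⟨i, j, hi, hj, hij, h0⟩
  | succ k => exact hg k (by omega)

theorem TranslocReach.ulamDist_le {α : Type*} {m : ℕ} {x y : List α}
    (h : TranslocReach m x y) : ulamDist x y ≤ m :=
  Nat.sInf_le h

theorem translocate_append_cons {α : Type*} {v₁ v₂ u₁ u₂ : List α} (a : α)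
    (h : v₁ ++ v₂ = u₁ ++ u₂) :
    translocate (v₁ ++ a :: v₂) v₁.length u₁.length = u₁ ++ a :: u₂ := by
  have hget : (v₁ ++ a :: v₂)[v₁.length]? = some a := by simp
  have herase : (v₁ ++ a :: v₂).eraseIdx v₁.length = v₁ ++ v₂ := by
    simp [List.eraseIdx_append_of_length_le]
  unfold translocate
  rw [hget]
  simp only [herase, h]
  clear h hget herase
  induction u₁ with
  | nil => simp
  | cons b u ih => simpa using ih

/-- Two arrangements of the same distinct symbols which agree after deleting the symbols of `s`
are at most `s.card` translocations apart. -/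
theorem exists_translocReach_of_filter_eq {α : Type*} [DecidableEq α] (s : Finset α)
    {x y : List α} (hx : x.Nodup) (hxy : x.Perm y)
    (h : x.filter (· ∉ s) = y.filter (· ∉ s)) :
    ∃ m ≤ s.card, TranslocReach m x y := by
  induction s using Finset.induction_on generalizing x with
  | empty =>
    simp only [Finset.notMem_empty, not_false_eq_true, decide_true, List.filter_true] at h
    exact ⟨0, le_rfl, h ▸ TranslocReach.refl x⟩
  | insert a s ha ih =>
    rw [Finset.card_insert_of_notMem ha]
    have hfilter : ∀ l : List α, a ∉ l →
        l.filter (· ∉ insert a s) = l.filter (· ∉ s) := by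
      intro l hl
      refine List.filter_congr fun b hb => ?_
      have : b ≠ a := fun e => hl (e ▸ hb)
      simp [this]
    by_cases hax : a ∈ x
    · obtain ⟨v₁, v₂, rfl⟩ := List.append_of_mem hax
      obtain ⟨y₁, y₂, rfl⟩ := List.append_of_mem (hxy.mem_iff.1 hax)
      have hv : a ∉ v₁ ++ v₂ := (List.nodup_middle.1 hx).notMem
      have hy : a ∉ y₁ ++ y₂ := (List.nodup_middle.1 (hxy.nodup_iff.1 hx)).notMem
      have hdel : (v₁ ++ v₂).filter (· ∉ s) = y₁.filter (· ∉ s) ++ y₂.filter (· ∉ s) := by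
        rw [← List.filter_append, ← hfilter _ hv, ← hfilter _ hy]
        simpa using h
      obtain ⟨u₁, u₂, hu, hu₁, hu₂⟩ := List.filter_eq_append_iff.1 hdel
      have hperm : (v₁ ++ a :: v₂).Perm (u₁ ++ a :: u₂) :=
        List.perm_middle.trans ((hu ▸ List.Perm.refl _ : (a :: (v₁ ++ v₂)).Perm
          (a :: (u₁ ++ u₂))).trans List.perm_middle.symm)
      obtain ⟨m, hm, hreach⟩ := ih (hperm.nodup_iff.1 hx) (hperm.symm.trans hxy)
        (by simp only [List.filter_append, List.filter_cons, hu₁, hu₂])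
      have hmove := translocate_append_cons a hu
      by_cases hlen : v₁.length = u₁.length
      · obtain ⟨rfl, rfl⟩ := List.append_inj hu hlen
        exact ⟨m, by omega, hreach⟩
      · have hlen' := congrArg List.length hu
        simp only [List.length_append] at hlen'
        refine ⟨m + 1, by omega, TranslocReach.cons (i := v₁.length) (j := u₁.length)
          ?_ ?_ hlen (hmove ▸ hreach)⟩ <;>
        · simp only [List.length_append, List.length_cons]
          omega
    · rw [hfilter _ hax, hfilter _ (fun hy => hax (hxy.mem_iff.2 hy))] at h
      obtain ⟨m, hm, hreach⟩ := ih hx hxy h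
      exact ⟨m, by omega, hreach⟩

theorem seqOf_nodup {n : ℕ} (π : Equiv.Perm (Fin n)) : (seqOf π).Nodup := by
  refine List.nodup_ofFn.2 fun i j hij => π.injective (Fin.ext ?_)
  simpa using hij

theorem mem_seqOf {n : ℕ} (π : Equiv.Perm (Fin n)) (a : ℕ) :
    a ∈ seqOf π ↔ 1 ≤ a ∧ a ≤ n := by
  simp only [seqOf, List.mem_ofFn]
  constructor
  · rintro ⟨i, rfl⟩
    have := (π i).isLt
    omega
  · rintro ⟨h1, h2⟩
    refine ⟨π.symm ⟨a - 1, by omega⟩, ?_⟩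
    simp only [Equiv.apply_symm_apply]
    omega

theorem dU_le_of_filter_eq {n : ℕ} (s : Finset ℕ) {π σ : Equiv.Perm (Fin n)}
    (h : (seqOf π).filter (· ∉ s) = (seqOf σ).filter (· ∉ s)) : dU π σ ≤ s.card := by
  obtain ⟨m, hm, hreach⟩ :=
    exists_translocReach_of_filter_eq s (seqOf_nodup π) (seqOf_perm π σ) h
  exact hreach.ulamDist_le.trans hm

theorem card_le_factorial_of_lt_dU {n t : ℕ} (htn : t ≤ n) (C : Finset (Equiv.Perm (Fin n)))
    (hC : ∀ π ∈ C, ∀ σ ∈ C, π ≠ σ → t < dU π σ) : C.card ≤ (n - t).factorial := by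
  have hcard : (Finset.Ioc (n - t) n).card = t := by
    rw [Nat.card_Ioc]
    omega
  calc C.card
      ≤ (List.range' 1 (n - t)).permutations.toFinset.card := by
        refine Finset.card_le_card_of_injOn
          (fun π => (seqOf π).filter (· ∉ Finset.Ioc (n - t) n)) (fun π _ => ?_) ?_
        · simp only [Finset.mem_coe, List.mem_toFinset, List.mem_permutations]
          refine (List.perm_ext_iff_of_nodup ((seqOf_nodup π).filter _)
            List.nodup_range').2 fun a => ?_
          simp only [List.mem_filter, mem_seqOf, Finset.mem_Ioc, decide_eq_true_eq,
            List.mem_range'_1]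
          omega
        · intro π hπ σ hσ h
          by_contra hne
          have := hC π hπ σ hσ hne
          have := dU_le_of_filter_eq _ h
          omega
    _ ≤ (List.range' 1 (n - t)).permutations.length := List.toFinset_card_le _
    _ = (n - t).factorial := by rw [List.length_permutations, List.length_range']

/-- sphere-packing upper bound: for all integers `n > t ≥ 1`,
`M(n,t) · C(n,t) ≤ n!/t!`; equivalently `M(n,t) ≤ (n−t)!`. -/
theorem stmt1 (n t : ℕ) (ht : 1 ≤ t) (htn : t < n) :
    Mnt n t * n.choose t ≤ n.factorial / t.factorial ∧ Mnt n t ≤ (n - t).factorial := by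
  have hM : Mnt n t ≤ (n - t).factorial := by
    refine csSup_le' ?_
    rintro m ⟨C, hC, rfl⟩
    exact card_le_factorial_of_lt_dU htn.le C hC
  refine ⟨?_, hM⟩
  rw [Nat.le_div_iff_mul_le t.factorial_pos, ← Nat.choose_mul_factorial_mul_factorial htn.le]
  calc Mnt n t * n.choose t * t.factorial
      ≤ (n - t).factorial * n.choose t * t.factorial := by gcongr
    _ = n.choose t * t.factorial * (n - t).factorial := by ring
end

section
/- For every fixed integer t ≥ 1 there exists a constant C depending only on t such that for all n and every permutation σ ∈ S_n, the number of sequences S = (φ_1, φ_2, ..., φ_m) of translocations with m ≤ 2t such that the permutation τ = σ φ_1 φ_2 ⋯ φ_m satisfies d_U(σ, τ) ≤ t is at most C · n^{3t}. -/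
open scoped Classical

/-- Apply a sequence of translocations (given as ordered pairs of positions,
left to right) to a sequence. -/
def applyTranslocs {α : Type*} (l : List α) (S : List (ℕ × ℕ)) : List α :=
  S.foldl (fun acc p => translocate acc p.1 p.2) l

section Chains

variable {α : Type*}

lemma insertIdx_eq_take_append_cons_drop (l : List α) {a : α} {j : ℕ} (hj : j ≤ l.length) :
    l.insertIdx j a = l.take j ++ a :: l.drop j := by
  induction l generalizing j with
  | nil => simp_all
  | cons x l ih =>
    cases j with
    | zero => simp
    | succ j => simpa using ih (by simpa using hj)

lemma mem_left_of_pair_sublist {l₁ l₂ : List α} {a m : α} (h : (l₁ ++ a :: l₂).Nodup)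
    (hs : [m, a].Sublist (l₁ ++ a :: l₂)) : m ∈ l₁ := by
  induction l₁ with
  | nil =>
    rw [List.nil_append, List.nodup_cons] at h
    rcases hs with _ | ⟨_, hs⟩ | ⟨_, hs⟩
    · exact absurd (hs.subset (by simp)) h.1
    · exact absurd (List.singleton_sublist.1 hs) h.1
  | cons x l₁ ih =>
    rw [List.cons_append] at h hs
    rcases hs with _ | ⟨_, hs⟩ | ⟨_, hs⟩
    · exact List.mem_cons_of_mem _ (ih h.of_cons hs)
    · exact List.mem_cons_self

lemma notMem_left_of_pair_sublist {l₁ l₂ : List α} {a m : α} (h : (l₁ ++ a :: l₂).Nodup)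
    (hs : [a, m].Sublist (l₁ ++ a :: l₂)) : m ∉ l₁ := by
  induction l₁ with
  | nil => simp
  | cons x l₁ ih =>
    rw [List.cons_append] at h hs
    have hx := (List.nodup_cons.1 h).1
    rcases hs with _ | ⟨_, hs⟩ | ⟨_, hs⟩
    · have hm : m ∈ l₁ ++ a :: l₂ := hs.subset (by simp)
      rw [List.mem_cons, not_or]
      exact ⟨fun e => hx (e ▸ hm), ih h.of_cons hs⟩
    · simp at hx

lemma pair_sublist_asymm {l : List α} (h : l.Nodup) {x y : α} (hxy : [x, y].Sublist l) :
    ¬ [y, x].Sublist l := by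
  intro hyx
  obtain ⟨l₁, l₂, rfl⟩ := List.append_of_mem (hxy.subset (by simp : x ∈ [x, y]))
  exact notMem_left_of_pair_sublist h hxy (mem_left_of_pair_sublist h hyx)

lemma pair_sublist_or {l : List α} {x y : α} (hx : x ∈ l) (hy : y ∈ l) (hxy : x ≠ y) :
    [x, y].Sublist l ∨ [y, x].Sublist l := by
  induction l with
  | nil => simp at hx
  | cons a l ih =>
    rw [List.mem_cons] at hx hy
    rcases hx with rfl | hx <;> rcases hy with rfl | hy
    · exact absurd rfl hxy
    · exact Or.inl (List.Sublist.cons_cons _ (List.singleton_sublist.2 hy))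
    · exact Or.inr (List.Sublist.cons_cons _ (List.singleton_sublist.2 hx))
    · exact (ih hx hy).imp (fun h => h.cons _) (fun h => h.cons _)

lemma nodup_insertIdx {l : List α} {a : α} {j : ℕ} (hl : l.Nodup) (ha : a ∉ l)
    (hj : j ≤ l.length) : (l.insertIdx j a).Nodup := by
  rw [(List.perm_insertIdx a l hj).nodup_iff, List.nodup_cons]
  exact ⟨ha, hl⟩

lemma translocate_eq {l : List α} {i : ℕ} (hi : i < l.length) (j : ℕ) :
    translocate l i j = (l.eraseIdx i).insertIdx j l[i] := by
  simp [translocate, hi]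

lemma translocate_perm {l : List α} {i j : ℕ} (hi : i < l.length) (hj : j < l.length) :
    (translocate l i j).Perm l := by
  rw [translocate_eq hi]
  have h := List.length_eraseIdx_of_lt hi
  exact (List.perm_insertIdx _ _ (by omega)).trans (List.getElem_cons_eraseIdx_perm hi)

variable [DecidableEq α]

lemma erase_insertIdx {l : List α} {a : α} {j : ℕ} (ha : a ∉ l) (hj : j ≤ l.length) :
    (l.insertIdx j a).erase a = l := by
  rw [insertIdx_eq_take_append_cons_drop l hj,
    List.erase_append_right _ (fun h => ha (List.mem_of_mem_take h)), List.erase_cons_head,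
    List.take_append_drop]

/-- Two symbols occur in `l` in the order prescribed by `r`. -/
def Compat (r : α → α → Prop) (l : List α) (x y : α) : Prop :=
  (r x y ∧ [x, y].Sublist l) ∨ (r y x ∧ [y, x].Sublist l)

/-- The sets of symbols of `l` that pairwise occur in the order prescribed by `r`. -/
noncomputable def chains (r : α → α → Prop) (l : List α) : Finset (Finset α) :=
  l.toFinset.powerset.filter fun s => (s : Set α).Pairwise (Compat r l)

/-- The largest size of a chain of `l`. -/
noncomputable def chainNum (r : α → α → Prop) (l : List α) : ℕ :=
  (chains r l).sup Finset.card

/-- The number of symbols of `l` outside a largest chain. -/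
noncomputable def defect (r : α → α → Prop) (l : List α) : ℕ :=
  l.length - chainNum r l

/-- The chains of `l` of largest size. -/
noncomputable def maxChains (r : α → α → Prop) (l : List α) : Finset (Finset α) :=
  (chains r l).filter fun s => s.card = chainNum r l

variable {r : α → α → Prop} {l l' : List α} {a : α} {s : Finset α}

lemma mem_chains : s ∈ chains r l ↔
    s ⊆ l.toFinset ∧ (s : Set α).Pairwise (Compat r l) := by
  simp [chains]

lemma mem_maxChains : s ∈ maxChains r l ↔ s ∈ chains r l ∧ s.card = chainNum r l := by
  simp [maxChains]

lemma card_le_chainNum (h : s ∈ chains r l) : s.card ≤ chainNum r l :=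
  Finset.le_sup (f := Finset.card) h

lemma maxChains_nonempty (r : α → α → Prop) (l : List α) : ∃ s, s ∈ maxChains r l := by
  have hne : (chains r l).Nonempty := ⟨∅, by simp [mem_chains]⟩
  obtain ⟨s, hs, h⟩ := Finset.exists_mem_eq_sup _ hne Finset.card
  exact ⟨s, mem_maxChains.2 ⟨hs, h.symm⟩⟩

lemma chains_mono (h : l'.Sublist l) : chains r l' ⊆ chains r l := by
  intro s hs
  rw [mem_chains] at hs ⊢
  refine ⟨fun x hx => ?_, hs.2.imp fun x y hxy => ?_⟩
  · have := hs.1 hx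
    rw [List.mem_toFinset] at this ⊢
    exact h.subset this
  · exact hxy.imp (fun h' => ⟨h'.1, h'.2.trans h⟩) (fun h' => ⟨h'.1, h'.2.trans h⟩)

lemma chainNum_mono (h : l'.Sublist l) : chainNum r l' ≤ chainNum r l :=
  Finset.sup_mono (chains_mono h)

lemma chainNum_le_length : chainNum r l ≤ l.length := by
  obtain ⟨s, hs⟩ := maxChains_nonempty r l
  rw [mem_maxChains, mem_chains] at hs
  rw [← hs.2]
  exact (Finset.card_le_card hs.1.1).trans (List.toFinset_card_le l)

lemma mem_chains_erase (hl : l.Nodup) (hs : s ∈ chains r l) (ha : a ∉ s) :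
    s ∈ chains r (l.erase a) := by
  rw [mem_chains] at hs ⊢
  refine ⟨fun x hx => ?_, fun x hx y hy hxy => ?_⟩
  · have := hs.1 hx
    rw [List.mem_toFinset] at this ⊢
    exact (List.mem_erase_of_ne (by rintro rfl; exact ha hx)).2 this
  · have key : ∀ x ∈ s, ∀ y ∈ s, [x, y].Sublist l → [x, y].Sublist (l.erase a) := by
      intro x hx y hy h
      have hxa : x ≠ a := by rintro rfl; exact ha hx
      have hya : y ≠ a := by rintro rfl; exact ha hy
      rw [hl.erase_eq_filter]
      simpa [hxa, hya] using h.filter (· != a)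
    exact (hs.2 hx hy hxy).imp (fun h => ⟨h.1, key x hx y hy h.2⟩)
      (fun h => ⟨h.1, key y hy x hx h.2⟩)

lemma erase_mem_chains_erase (hl : l.Nodup) (hs : s ∈ chains r l) :
    s.erase a ∈ chains r (l.erase a) := by
  refine mem_chains_erase hl ?_ (Finset.notMem_erase a s)
  rw [mem_chains] at hs ⊢
  exact ⟨(Finset.erase_subset a s).trans hs.1,
    hs.2.mono (by exact_mod_cast Finset.erase_subset a s)⟩

lemma chainNum_le_chainNum_erase_add_one (hl : l.Nodup) (a : α) :
    chainNum r l ≤ chainNum r (l.erase a) + 1 := by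
  obtain ⟨s, hs⟩ := maxChains_nonempty r l
  rw [mem_maxChains] at hs
  have h1 := card_le_chainNum (erase_mem_chains_erase (a := a) hl hs.1)
  have h2 := Finset.pred_card_le_card_erase (s := s) (a := a)
  omega

lemma card_sdiff_of_mem_maxChains (hl : l.Nodup) (hs : s ∈ maxChains r l) :
    (l.toFinset \ s).card = defect r l := by
  rw [mem_maxChains, mem_chains] at hs
  rw [Finset.card_sdiff_of_subset hs.1.1, hs.2, List.toFinset_card_of_nodup hl, defect]

lemma card_maxChains_le (hl : l.Nodup) : (maxChains r l).card ≤ 2 ^ defect r l := by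
  obtain ⟨L, hL⟩ := maxChains_nonempty r l
  have hL' := (mem_chains.1 (mem_maxChains.1 hL).1).2
  rw [← card_sdiff_of_mem_maxChains hl hL, ← Finset.card_powerset]
  refine Finset.card_le_card_of_injOn (fun s => s \ L) (fun s hs => ?_) ?_
  · have := mem_chains.1 (mem_maxChains.1 hs).1
    exact Finset.mem_powerset.2 (Finset.sdiff_subset_sdiff this.1 le_rfl)
  · intro s hs s' hs' h
    have h1 := mem_chains.1 (mem_maxChains.1 hs).1
    have h2 := mem_chains.1 (mem_maxChains.1 hs').1
    have hmem : ∀ x, x ∉ L → (x ∈ s ↔ x ∈ s') := by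
      intro x hx
      have := Finset.ext_iff.1 h x
      simpa [hx] using this
    have hu : s ∪ s' ∈ chains r l := by
      rw [mem_chains]
      refine ⟨Finset.union_subset h1.1 h2.1, ?_⟩
      intro x hx y hy hxy
      by_cases hxL : x ∈ L
      · by_cases hyL : y ∈ L
        · exact hL' hxL hyL hxy
        · have := hmem y hyL
          simp only [Finset.coe_union, Set.mem_union, Finset.mem_coe] at hx hy
          rcases hx with hx | hx
          · exact h1.2 hx (by simp only [Finset.mem_coe]; tauto) hxy
          · exact h2.2 hx (by simp only [Finset.mem_coe]; tauto) hxy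
      · have := hmem x hxL
        simp only [Finset.coe_union, Set.mem_union, Finset.mem_coe] at hx hy
        rcases hy with hy | hy
        · exact h1.2 (by simp only [Finset.mem_coe]; tauto) hy hxy
        · exact h2.2 (by simp only [Finset.mem_coe]; tauto) hy hxy
    have hc := card_le_chainNum hu
    have e1 := Finset.eq_of_subset_of_card_le (Finset.subset_union_left (s₁ := s) (s₂ := s'))
      (by rw [(mem_maxChains.1 hs).2]; exact hc)
    have e2 := Finset.eq_of_subset_of_card_le (Finset.subset_union_right (s₁ := s) (s₂ := s'))
      (by rw [(mem_maxChains.1 hs').2]; exact hc)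
    exact e1.trans e2.symm

/-- Few deletions keep the size of a largest chain. -/
lemma card_eraseIdx_chainNum_eq_le (hl : l.Nodup) :
    ((Finset.range l.length).filter fun i => chainNum r (l.eraseIdx i) = chainNum r l).card ≤
      2 ^ defect r l * defect r l := by
  have hsub : ((Finset.range l.length).filter
      fun i => chainNum r (l.eraseIdx i) = chainNum r l) ⊆
      ((maxChains r l).biUnion fun s => l.toFinset \ s).image l.idxOf := by
    intro i hi
    rw [Finset.mem_filter, Finset.mem_range] at hi
    obtain ⟨hi, h⟩ := hi
    obtain ⟨s, hs⟩ := maxChains_nonempty r (l.eraseIdx i)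
    rw [mem_maxChains] at hs
    refine Finset.mem_image.2 ⟨l[i], ?_, hl.idxOf_getElem i hi⟩
    simp only [Finset.mem_biUnion, Finset.mem_sdiff, List.mem_toFinset]
    refine ⟨s, mem_maxChains.2 ⟨chains_mono (List.eraseIdx_sublist l i) hs.1, hs.2.trans h⟩,
      List.getElem_mem hi, fun hmem => ?_⟩
    have h1 := (mem_chains.1 hs.1).1 hmem
    rw [List.mem_toFinset, ← hl.erase_getElem i hi] at h1
    exact hl.not_mem_erase h1
  refine (Finset.card_le_card hsub).trans (Finset.card_image_le.trans (Finset.card_biUnion_le.trans ?_))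
  rw [Finset.sum_congr rfl fun s hs => card_sdiff_of_mem_maxChains hl hs]
  simpa using Nat.mul_le_mul_right _ (card_maxChains_le hl)

/-- Few positions let an inserted symbol extend a given largest chain. -/
lemma card_insertIdx_extends_le (hr : ∀ x y, r x y → ¬ r y x) (hl : l.Nodup) (ha : a ∉ l)
    (hs : s ∈ maxChains r l) :
    ((Finset.range (l.length + 1)).filter
      fun j => insert a s ∈ chains r (l.insertIdx j a)).card ≤ defect r l + 1 := by
  set c := (s.filter fun m => r m a).card
  have hsub : ((Finset.range (l.length + 1)).filter
      fun j => insert a s ∈ chains r (l.insertIdx j a)) ⊆ Finset.Icc c (c + defect r l) := by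
    intro j hj
    rw [Finset.mem_filter, Finset.mem_range, mem_chains] at hj
    obtain ⟨hj, -, hp⟩ := hj
    have hsl := (mem_chains.1 (mem_maxChains.1 hs).1).1
    have hnd : (l.take j ++ l.drop j).Nodup := by rwa [List.take_append_drop]
    have heq : l.insertIdx j a = l.take j ++ a :: l.drop j :=
      insertIdx_eq_take_append_cons_drop l (by omega)
    rw [heq] at hp
    have hnd' : (l.take j ++ a :: l.drop j).Nodup := by
      rw [List.nodup_middle, List.nodup_cons, List.take_append_drop]
      exact ⟨ha, hl⟩
    have hmem : ∀ m ∈ s, (m ∈ l.take j ↔ r m a) := by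
      intro m hm
      have hml : m ∈ l := by simpa using hsl hm
      have hma : m ≠ a := by rintro rfl; exact ha hml
      have before : [m, a].Sublist (l.take j ++ a :: l.drop j) → m ∈ l.take j := by
        intro h
        exact mem_left_of_pair_sublist hnd' h
      have after : [a, m].Sublist (l.take j ++ a :: l.drop j) → m ∉ l.take j := by
        intro h
        exact notMem_left_of_pair_sublist hnd' h
      have := hp (x := m) (by simp [hm]) (y := a) (by simp) hma
      have := hr m a
      unfold Compat at *
      tauto
    have hcard : (l.take j).toFinset.card = j := by
      rw [List.toFinset_card_of_nodup hnd.of_append_left, List.length_take]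
      omega
    have hsplit := Finset.card_inter_add_card_sdiff (l.take j).toFinset s
    have hint : (l.take j).toFinset ∩ s = s.filter fun m => r m a := by
      ext m
      have := hmem m
      simp only [Finset.mem_inter, List.mem_toFinset, Finset.mem_filter]
      tauto
    have hle : ((l.take j).toFinset \ s).card ≤ defect r l := by
      rw [← card_sdiff_of_mem_maxChains hl hs]
      refine Finset.card_le_card (Finset.sdiff_subset_sdiff (fun x hx => ?_) le_rfl)
      rw [List.mem_toFinset] at hx ⊢
      exact List.mem_of_mem_take hx
    rw [hint] at hsplit
    rw [Finset.mem_Icc]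
    omega
  refine (Finset.card_le_card hsub).trans ?_
  rw [Nat.card_Icc]
  omega

/-- Few insertions of a symbol enlarge the largest chains. -/
lemma card_insertIdx_chainNum_lt_le (hr : ∀ x y, r x y → ¬ r y x) (hl : l.Nodup) (ha : a ∉ l) :
    ((Finset.range (l.length + 1)).filter
      fun j => chainNum r l < chainNum r (l.insertIdx j a)).card ≤
      2 ^ defect r l * (defect r l + 1) := by
  have hsub : ((Finset.range (l.length + 1)).filter
      fun j => chainNum r l < chainNum r (l.insertIdx j a)) ⊆
      (maxChains r l).biUnion fun s => (Finset.range (l.length + 1)).filter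
        fun j => insert a s ∈ chains r (l.insertIdx j a) := by
    intro j hj
    rw [Finset.mem_filter, Finset.mem_range] at hj
    have hnd : (l.insertIdx j a).Nodup :=
      nodup_insertIdx hl ha (by omega)
    have her : (l.insertIdx j a).erase a = l :=
      erase_insertIdx ha (by omega)
    obtain ⟨K, hK⟩ := maxChains_nonempty r (l.insertIdx j a)
    rw [mem_maxChains] at hK
    have haK : a ∈ K := by
      by_contra haK
      have := card_le_chainNum (mem_chains_erase hnd hK.1 haK)
      rw [her] at this
      omega
    have h1 := erase_mem_chains_erase (a := a) hnd hK.1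
    rw [her] at h1
    have h2 := card_le_chainNum h1
    have h3 := Finset.card_erase_of_mem haK
    simp only [Finset.mem_biUnion, Finset.mem_filter, Finset.mem_range, mem_maxChains]
    refine ⟨K.erase a, ⟨h1, by omega⟩, hj.1, ?_⟩
    rw [Finset.insert_erase haK]
    exact hK.1
  refine (Finset.card_le_card hsub).trans (Finset.card_biUnion_le.trans ?_)
  refine (Finset.sum_le_sum fun s hs => card_insertIdx_extends_le hr hl ha hs).trans ?_
  rw [Finset.sum_const, smul_eq_mul]
  exact Nat.mul_le_mul_right _ (card_maxChains_le hl)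

lemma defect_insertIdx_le {j : ℕ} (hj : j ≤ l.length) :
    defect r (l.insertIdx j a) ≤ defect r l + 1 := by
  have h1 := chainNum_mono (r := r) (List.sublist_insertIdx l j a)
  have h2 := List.length_insertIdx_of_le_length hj a
  unfold defect
  omega

lemma defect_eraseIdx_le (hl : l.Nodup) {i : ℕ} (hi : i < l.length) :
    defect r (l.eraseIdx i) ≤ defect r l := by
  have h1 := chainNum_le_chainNum_erase_add_one (r := r) hl l[i]
  rw [hl.erase_getElem i hi] at h1
  have h2 := List.length_eraseIdx_of_lt hi
  unfold defect
  omega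

lemma defect_self_eq_zero (hl : l.Nodup) : defect (fun x y => [x, y].Sublist l) l = 0 := by
  have h : l.toFinset ∈ chains (fun x y => [x, y].Sublist l) l := by
    refine mem_chains.2 ⟨le_rfl, fun x hx y hy hxy => ?_⟩
    simp only [List.coe_toFinset, Set.mem_ofPred_eq] at hx hy
    exact (pair_sublist_or hx hy hxy).imp (fun h => ⟨h, h⟩) (fun h => ⟨h, h⟩)
  have h1 := card_le_chainNum h
  rw [List.toFinset_card_of_nodup hl] at h1
  unfold defect
  omega

lemma pow_mul_succ_le {d B : ℕ} (h : d ≤ B) : 2 ^ d * (d + 1) ≤ 2 ^ B * (B + 1) :=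
  Nat.mul_le_mul (Nat.pow_le_pow_right (by norm_num) h) (by omega)

lemma sum_le_of_card_filter_le {ι : Type*} {s : Finset ι} {f : ι → ℝ} {p : ι → Prop}
    [DecidablePred p] {A b : ℝ} {K N : ℕ} (hA : 0 ≤ A) (hb : 0 ≤ b) (h1 : ∀ i ∈ s, p i → f i ≤ A)
    (h2 : ∀ i ∈ s, ¬ p i → f i ≤ b) (hK : (s.filter p).card ≤ K) (hN : s.card ≤ N) :
    ∑ i ∈ s, f i ≤ K * A + N * b := by
  rw [← Finset.sum_filter_add_sum_filter_not s p]
  refine add_le_add ?_ ?_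
  · refine (Finset.sum_le_card_nsmul _ _ A fun i hi => ?_).trans ?_
    · rw [Finset.mem_filter] at hi
      exact h1 i hi.1 hi.2
    · rw [nsmul_eq_mul]
      gcongr
  · refine (Finset.sum_le_card_nsmul _ _ b fun i hi => ?_).trans ?_
    · rw [Finset.mem_filter] at hi
      exact h2 i hi.1 hi.2
    · rw [nsmul_eq_mul]
      gcongr
      exact (Finset.card_filter_le _ _).trans hN

lemma sum_insertIdx_le (hr : ∀ x y, r x y → ¬ r y x) (hl : l.Nodup) (ha : a ∉ l) {n B : ℕ}
    (hn : l.length + 1 = n) (hB : defect r l ≤ B) :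
    ∑ j ∈ Finset.range n, ((n : ℝ)⁻¹) ^ defect r (l.insertIdx j a) ≤
      (2 ^ B * (B + 1) + 1 : ℕ) * ((n : ℝ)⁻¹) ^ defect r l := by
  subst hn
  have hpos : ((l.length + 1 : ℕ) : ℝ) ≠ 0 := by positivity
  have hlen : ∀ j ∈ Finset.range (l.length + 1), (l.insertIdx j a).length = l.length + 1 := by
    intro j hj
    rw [Finset.mem_range] at hj
    exact List.length_insertIdx_of_le_length (by omega) a
  have hcl := chainNum_le_length (r := r) (l := l)
  have hcm : ∀ j, chainNum r l ≤ chainNum r (l.insertIdx j a) := fun j =>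
    chainNum_mono (List.sublist_insertIdx l j a)
  refine (sum_le_of_card_filter_le (by positivity) (by positivity)
    (A := (((l.length + 1 : ℕ) : ℝ)⁻¹) ^ defect r l)
    (b := (((l.length + 1 : ℕ) : ℝ)⁻¹) ^ (defect r l + 1))
    (K := 2 ^ B * (B + 1)) (N := l.length + 1)
    (p := fun j => chainNum r l < chainNum r (l.insertIdx j a)) ?_ ?_
    ((card_insertIdx_chainNum_lt_le hr hl ha).trans (pow_mul_succ_le hB))
    (Finset.card_range _).le).trans ?_
  · intro j hj hlt
    have h1 := hlen j hj
    rw [Finset.mem_range] at hj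
    have h2 := chainNum_le_chainNum_erase_add_one (r := r)
      (nodup_insertIdx hl ha (by omega : j ≤ l.length)) a
    rw [erase_insertIdx ha (by omega)] at h2
    have : defect r (l.insertIdx j a) = defect r l := by
      unfold defect
      omega
    rw [this]
  · intro j hj hlt
    have h1 := hlen j hj
    have h2 := hcm j
    have : defect r (l.insertIdx j a) = defect r l + 1 := by
      unfold defect
      omega
    rw [this]
  · refine le_of_eq ?_
    rw [pow_succ]
    push_cast at hpos ⊢
    field_simp

lemma sum_eraseIdx_le (hl : l.Nodup) {n B : ℕ} (hn : l.length = n) (hB : defect r l ≤ B) :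
    ∑ i ∈ Finset.range n, ((n : ℝ)⁻¹) ^ defect r (l.eraseIdx i) ≤
      (2 ^ B * (B + 1) + 1 : ℕ) * n * ((n : ℝ)⁻¹) ^ defect r l := by
  subst hn
  refine (sum_le_of_card_filter_le (by positivity) (by positivity)
    (A := l.length * ((l.length : ℝ)⁻¹) ^ defect r l)
    (b := ((l.length : ℝ)⁻¹) ^ defect r l)
    (K := 2 ^ B * (B + 1)) (N := l.length)
    (p := fun i => chainNum r (l.eraseIdx i) = chainNum r l) ?_ ?_
    ((card_eraseIdx_chainNum_eq_le hl).trans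
      ((Nat.mul_le_mul_left _ (Nat.le_succ _)).trans (pow_mul_succ_le hB)))
    (Finset.card_range _).le).trans ?_
  · intro i hi heq
    rw [Finset.mem_range] at hi
    have h1 := List.length_eraseIdx_of_lt hi
    have h2 := chainNum_le_length (r := r) (l := l.eraseIdx i)
    have : defect r l = defect r (l.eraseIdx i) + 1 := by
      unfold defect
      omega
    have hpos : (l.length : ℝ) ≠ 0 := by
      have : l.length ≠ 0 := by omega
      exact_mod_cast this
    rw [this, pow_succ]
    refine le_of_eq ?_
    field_simp
  · intro i hi hne
    rw [Finset.mem_range] at hi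
    have h1 := List.length_eraseIdx_of_lt hi
    have h2 := chainNum_mono (r := r) (List.eraseIdx_sublist l i)
    have h3 := chainNum_le_chainNum_erase_add_one (r := r) hl l[i]
    rw [hl.erase_getElem i hi] at h3
    have : defect r (l.eraseIdx i) = defect r l := by
      unfold defect
      omega
    rw [this]
  · refine le_of_eq ?_
    push_cast
    ring

lemma defect_translocate_le (hl : l.Nodup) {i j : ℕ} (hi : i < l.length) (hj : j < l.length) :
    defect r (translocate l i j) ≤ defect r l + 1 := by
  rw [translocate_eq hi]
  have h := List.length_eraseIdx_of_lt hi
  exact (defect_insertIdx_le (by omega)).trans (Nat.succ_le_succ (defect_eraseIdx_le hl hi))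

lemma sum_translocate_le (hr : ∀ x y, r x y → ¬ r y x) (hl : l.Nodup) {n B : ℕ}
    (hn : l.length = n) (hB : defect r l ≤ B) :
    ∑ p ∈ Finset.range n ×ˢ Finset.range n, ((n : ℝ)⁻¹) ^ defect r (translocate l p.1 p.2) ≤
      (2 ^ B * (B + 1) + 1 : ℕ) ^ 2 * n * ((n : ℝ)⁻¹) ^ defect r l := by
  rw [Finset.sum_product]
  calc _ ≤ ∑ i ∈ Finset.range n,
        ((2 ^ B * (B + 1) + 1 : ℕ) : ℝ) * ((n : ℝ)⁻¹) ^ defect r (l.eraseIdx i) := by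
        refine Finset.sum_le_sum fun i hi => ?_
        rw [Finset.mem_range, ← hn] at hi
        have hlen := List.length_eraseIdx_of_lt hi
        simp only [translocate_eq hi]
        refine sum_insertIdx_le hr (hl.sublist (List.eraseIdx_sublist l i)) ?_ (by omega)
          ((defect_eraseIdx_le hl hi).trans hB)
        rw [← hl.erase_getElem i hi]
        exact hl.not_mem_erase
    _ ≤ _ := by
        rw [← Finset.mul_sum, pow_two, mul_assoc, mul_assoc]
        gcongr
        rw [← mul_assoc]
        exact sum_eraseIdx_le hl hn hB

/-- The sequences of `m` pairs of positions below `n`. -/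
def translocSeqs (n : ℕ) : ℕ → Finset (List (ℕ × ℕ))
  | 0 => {[]}
  | m + 1 => ((Finset.range n ×ˢ Finset.range n) ×ˢ translocSeqs n m).image fun x => x.1 :: x.2

lemma mem_translocSeqs {n : ℕ} {S : List (ℕ × ℕ)} (hS : ∀ p ∈ S, p.1 < n ∧ p.2 < n) :
    S ∈ translocSeqs n S.length := by
  induction S with
  | nil => simp [translocSeqs]
  | cons p S ih =>
    rw [List.forall_mem_cons] at hS
    refine Finset.mem_image.2 ⟨(p, S), ?_, rfl⟩
    simp only [Finset.mem_product, Finset.mem_range]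
    exact ⟨hS.1, ih hS.2⟩

lemma sum_applyTranslocs_le (hr : ∀ x y, r x y → ¬ r y x) {n B : ℕ} (m : ℕ) (l : List α)
    (hl : l.Nodup) (hn : l.length = n) (hB : defect r l + m ≤ B) :
    ∑ S ∈ translocSeqs n m, ((n : ℝ)⁻¹) ^ defect r (applyTranslocs l S) ≤
      ((2 ^ B * (B + 1) + 1 : ℕ) ^ 2 * n) ^ m * ((n : ℝ)⁻¹) ^ defect r l := by
  induction m generalizing l with
  | zero => simp [translocSeqs, applyTranslocs]
  | succ m ih =>
    rw [translocSeqs, Finset.sum_image (by rintro ⟨p, S⟩ - ⟨p', S'⟩ - h; simpa using h),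
      Finset.sum_product]
    calc _ ≤ ∑ p ∈ Finset.range n ×ˢ Finset.range n,
          (((2 ^ B * (B + 1) + 1 : ℕ) : ℝ) ^ 2 * n) ^ m *
            ((n : ℝ)⁻¹) ^ defect r (translocate l p.1 p.2) := by
          refine Finset.sum_le_sum fun p hp => ?_
          rw [Finset.mem_product, Finset.mem_range, Finset.mem_range, ← hn] at hp
          have hperm := translocate_perm hp.1 hp.2
          have hd := defect_translocate_le (r := r) hl hp.1 hp.2
          exact ih (translocate l p.1 p.2) (hperm.nodup_iff.2 hl) (hperm.length_eq.trans hn)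
            (by omega)
      _ ≤ _ := by
          rw [← Finset.mul_sum, pow_succ _ m, mul_assoc]
          gcongr
          exact sum_translocate_le hr hl hn ((Nat.le_add_right _ _).trans hB)

lemma defect_le_ulamDist (hl : l.Nodup) (h0 : defect r l = 0) {S : List (ℕ × ℕ)}
    (hS : ∀ p ∈ S, p.1 < l.length ∧ p.2 < l.length ∧ p.1 ≠ p.2) :
    defect r (applyTranslocs l S) ≤ ulamDist l (applyTranslocs l S) := by
  have hne : {m | ∃ g : ℕ → List α, g 0 = l ∧ g m = applyTranslocs l S ∧
      ∀ k < m, ∃ i j, i < (g k).length ∧ j < (g k).length ∧ i ≠ j ∧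
        g (k+1) = translocate (g k) i j}.Nonempty := by
    have hstep : ∀ k (hk : k < S.length), applyTranslocs l (S.take (k + 1)) =
        translocate (applyTranslocs l (S.take k)) S[k].1 S[k].2 := by
      intro k hk
      rw [List.take_succ_eq_append_getElem hk, applyTranslocs, List.foldl_append]
      rfl
    have hlen : ∀ k ≤ S.length, (applyTranslocs l (S.take k)).length = l.length := by
      intro k
      induction k with
      | zero => simp [applyTranslocs]
      | succ k ih =>
        intro hk
        have hS' := hS S[k] (List.getElem_mem _)
        have ih' := ih (by omega)
        rw [hstep k hk, (translocate_perm (by omega) (by omega)).length_eq, ih']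
    refine ⟨S.length, fun k => applyTranslocs l (S.take k), by simp [applyTranslocs], by simp,
      fun k hk => ⟨S[k].1, S[k].2, ?_⟩⟩
    have hS' := hS S[k] (List.getElem_mem _)
    simp only [hlen k hk.le]
    exact ⟨hS'.1, hS'.2.1, hS'.2.2, hstep k hk⟩
  obtain ⟨g, hg0, hgm, hg⟩ := Nat.sInf_mem hne
  have key : ∀ k ≤ ulamDist l (applyTranslocs l S), (g k).Nodup ∧ defect r (g k) ≤ k := by
    intro k
    induction k with
    | zero => simp [hg0, hl, h0]
    | succ k ih =>
      intro hk
      obtain ⟨hnd, hd⟩ := ih (by omega)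
      obtain ⟨i, j, hi, hj, -, he⟩ := hg k hk
      rw [he]
      exact ⟨(translocate_perm hi hj).nodup_iff.2 hnd,
        (defect_translocate_le hnd hi hj).trans (by omega)⟩
  have := (key _ le_rfl).2
  rwa [show g (ulamDist l (applyTranslocs l S)) = applyTranslocs l S from hgm] at this

end Chains

/-- for every fixed `t ≥ 1` there is a constant `C` such that for every `n`
and every `σ ∈ S_n`, the number of translocation sequences `S` of length at most `2t`
with `d_U(σ, σ∘S) ≤ t` is at most `C · n^{3t}`. -/
theorem stmt5 (t : ℕ) (ht : 1 ≤ t) :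
    ∃ C : ℕ, ∀ n : ℕ, 1 ≤ n → ∀ σ : Equiv.Perm (Fin n),
      ({S : List (ℕ × ℕ) | S.length ≤ 2 * t ∧
          (∀ p ∈ S, p.1 < n ∧ p.2 < n ∧ p.1 ≠ p.2) ∧
          ulamDist (seqOf σ) (applyTranslocs (seqOf σ) S) ≤ t}).ncard ≤
        C * n ^ (3 * t) := by
  set K : ℕ := 2 ^ (2 * t) * (2 * t + 1) + 1
  refine ⟨(2 * t + 1) * (K ^ 2) ^ (2 * t), fun n hn σ => ?_⟩
  set l := seqOf σ
  have hl : l.Nodup := by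
    refine List.nodup_ofFn.2 fun i j h => ?_
    simpa [Fin.val_inj] using h
  have hlen : l.length = n := List.length_ofFn
  set r : ℕ → ℕ → Prop := fun x y => [x, y].Sublist l
  have h0 : defect r l = 0 := defect_self_eq_zero hl
  have hr : ∀ x y, r x y → ¬ r y x := fun x y h => pair_sublist_asymm hl h
  have hnR : (1 : ℝ) ≤ n := by exact_mod_cast hn
  have hK : (1 : ℝ) ≤ K := by exact_mod_cast Nat.le_add_left 1 _
  set T : ℕ → Finset (List (ℕ × ℕ)) := fun m =>
    (translocSeqs n m).filter fun S => defect r (applyTranslocs l S) ≤ t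
  have hT : ∀ m ≤ 2 * t, (T m).card ≤ (K ^ 2) ^ (2 * t) * n ^ (3 * t) := by
    intro m hm
    have hsum := sum_applyTranslocs_le hr (B := 2 * t) m l hl hlen (by omega)
    rw [h0, pow_zero, mul_one] at hsum
    have hcard : ((T m).card : ℝ) * ((n : ℝ)⁻¹) ^ t ≤ ((K : ℝ) ^ 2 * n) ^ m := by
      refine le_trans ?_ hsum
      rw [← nsmul_eq_mul]
      refine (Finset.card_nsmul_le_sum _ _ _ fun S hS => ?_).trans
        (Finset.sum_le_sum_of_subset_of_nonneg (Finset.filter_subset _ _)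
          fun _ _ _ => by positivity)
      exact pow_le_pow_of_le_one (by positivity) (inv_le_one_of_one_le₀ hnR)
        (Finset.mem_filter.1 hS).2
    have hbound : ((T m).card : ℝ) ≤ ((K : ℝ) ^ 2) ^ (2 * t) * (n : ℝ) ^ (3 * t) := by
      calc ((T m).card : ℝ) = (T m).card * ((n : ℝ)⁻¹) ^ t * (n : ℝ) ^ t := by
            rw [mul_assoc, ← mul_pow, inv_mul_cancel₀ (by positivity), one_pow, mul_one]
        _ ≤ ((K : ℝ) ^ 2 * n) ^ m * (n : ℝ) ^ t := by gcongr
        _ ≤ ((K : ℝ) ^ 2 * n) ^ (2 * t) * (n : ℝ) ^ t := by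
            gcongr
            exact one_le_mul_of_one_le_of_one_le (one_le_pow₀ hK) hnR
        _ = ((K : ℝ) ^ 2) ^ (2 * t) * (n : ℝ) ^ (3 * t) := by ring
    exact_mod_cast hbound
  have hsub : {S : List (ℕ × ℕ) | S.length ≤ 2 * t ∧
      (∀ p ∈ S, p.1 < n ∧ p.2 < n ∧ p.1 ≠ p.2) ∧ ulamDist l (applyTranslocs l S) ≤ t} ⊆
      ((Finset.range (2 * t + 1)).biUnion T : Finset (List (ℕ × ℕ))) := by
    rintro S ⟨hS1, hS2, hS3⟩
    rw [Finset.mem_coe, Finset.mem_biUnion]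
    refine ⟨S.length, Finset.mem_range.2 (by omega), Finset.mem_filter.2
      ⟨mem_translocSeqs fun p hp => ⟨(hS2 p hp).1, (hS2 p hp).2.1⟩, ?_⟩⟩
    exact (defect_le_ulamDist hl h0 (by rwa [hlen])).trans hS3
  refine (Set.ncard_le_ncard hsub (Finset.finite_toSet _)).trans ?_
  rw [Set.ncard_coe_finset]
  refine (Finset.card_biUnion_le.trans (Finset.sum_le_card_nsmul _ _ _ fun m hm =>
    hT m (Nat.lt_succ_iff.1 (Finset.mem_range.1 hm)))).trans ?_
  rw [Finset.card_range, smul_eq_mul, mul_assoc]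
end

section
/- Let π ∈ S_n and let σ = π φ(i,j) be obtained from π by a single translocation with distinct indices i < j. Then the Hamming distance between f(π̄) and f(σ̄) is exactly 3, where they differ precisely at the three positions π̄_{i−1}, π̄_i, and π̄_j (with π̄_0 interpreted cyclically as π̄_{n+1} = n+1). -/
open scoped Classical

theorem bar_castSucc {n : ℕ} (π : Equiv.Perm (Fin n)) (p : Fin n) :
    bar π p.castSucc = (π p).castSucc := by
  simp [bar]

theorem bar_last {n : ℕ} (π : Equiv.Perm (Fin n)) : bar π (Fin.last n) = Fin.last n := by
  simp [bar]

/-- The position in `l` of the symbol at position `p` of `translocate l i j`, for `i < j`. -/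
def translocateIdx (i j p : ℕ) : ℕ :=
  if p < i then p else if p < j then p + 1 else if p = j then i else p

theorem translocateIdx_lt {i j m p : ℕ} (hij : i < j) (hj : j < m) (hp : p < m) :
    translocateIdx i j p < m := by
  unfold translocateIdx
  split_ifs <;> omega

theorem translocate_getElem? {α : Type*} (l : List α) {i j p : ℕ} (hij : i < j)
    (hj : j < l.length) (hp : p < l.length) :
    (translocate l i j)[p]? = l[translocateIdx i j p]? := by
  have hi : i < l.length := by omega
  simp only [translocate, List.getElem?_eq_getElem hi, List.getElem?_insertIdx,
    List.getElem?_eraseIdx, List.length_eraseIdx, translocateIdx]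
  grind

theorem apply_eq_of_seqOf_eq_translocate {n : ℕ} {π σ : Equiv.Perm (Fin n)} {i j : Fin n}
    (hij : i < j) (hσ : seqOf σ = translocate (seqOf π) i j) (p : Fin n) :
    σ p = π ⟨translocateIdx i j p, translocateIdx_lt hij j.2 p.2⟩ := by
  have h := congrArg (fun l => l[(p : ℕ)]?) hσ
  have ht : translocateIdx i j p < n := translocateIdx_lt hij j.2 p.2
  rw [translocate_getElem? _ hij (by simp [seqOf]) (by simp [seqOf])] at h
  simp only [seqOf, List.getElem?_ofFn, p.2, ht, dite_true, Option.some.injEq] at h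
  exact Fin.ext (by simpa using h)

theorem bar_apply_eq_of_seqOf_eq_translocate {n : ℕ} {π σ : Equiv.Perm (Fin n)} {i j : Fin n}
    (hij : i < j) (hσ : seqOf σ = translocate (seqOf π) i j) (p : Fin (n + 1)) :
    bar σ p = bar π ⟨translocateIdx i j p,
      translocateIdx_lt hij (j.2.trans n.lt_succ_self) p.2⟩ := by
  induction p using Fin.lastCases with
  | last =>
    have h : translocateIdx i j n = n := by
      have := j.2
      unfold translocateIdx
      split_ifs <;> omega
    simp only [bar_last, Fin.val_last, h]
    exact (bar_last π).symm
  | cast p =>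
    rw [bar_castSucc, apply_eq_of_seqOf_eq_translocate hij hσ, ← bar_castSucc]
    rfl

theorem fmap_bar {n : ℕ} (π : Equiv.Perm (Fin n)) (p : Fin (n + 1)) :
    fmap π (bar π p) = bar π (finRotate (n + 1) p) := by
  simp [fmap]

theorem val_finRotate {n : ℕ} (p : Fin (n + 1)) :
    (finRotate (n + 1) p : ℕ) = if (p : ℕ) = n then 0 else (p : ℕ) + 1 := by
  rw [coe_finRotate]
  simp [Fin.ext_iff]

theorem fmap_ne_fmap_iff {n : ℕ} {π σ : Equiv.Perm (Fin n)} {i j : Fin n}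
    (hij : i < j) (hσ : seqOf σ = translocate (seqOf π) i j) (k : Fin (n + 1)) :
    fmap π k ≠ fmap σ k ↔ k = bar π ((finRotate (n + 1)).symm i.castSucc) ∨
      k = bar π i.castSucc ∨ k = bar π j.castSucc := by
  obtain ⟨p, rfl⟩ := (bar σ).surjective k
  rw [fmap_bar]
  simp only [bar_apply_eq_of_seqOf_eq_translocate hij hσ, fmap_bar, ne_eq,
    EmbeddingLike.apply_eq_iff_eq, Equiv.eq_symm_apply, Fin.ext_iff, val_finRotate,
    Fin.val_castSucc]
  have := p.2
  have := j.2
  have hij' : (i : ℕ) < j := hij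
  unfold translocateIdx
  grind

/-- if `σ = π φ(i,j)` is obtained from `π` by a single translocation
with `i < j`, then `f(π̄)` and `f(σ̄)` differ exactly at the three positions
`π̄_{i−1}`, `π̄_i`, `π̄_j` (with `π̄_0` interpreted cyclically as `π̄_{n+1} = n+1`),
and hence `d_H(f(π̄), f(σ̄)) = 3`. (Positions are `0`-indexed here.) -/
theorem stmt9 (n : ℕ) (π σ : Equiv.Perm (Fin n)) (i j : Fin n) (hij : i < j)
    (hσ : seqOf σ = translocate (seqOf π) (i : ℕ) (j : ℕ)) :
    {k : Fin (n+1) | fmap π k ≠ fmap σ k} =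
      {bar π ((finRotate (n+1)).symm (Fin.castSucc i)),
       bar π (Fin.castSucc i), bar π (Fin.castSucc j)} ∧
    dH (fmap π) (fmap σ) = 3 := by
  have hset := fmap_ne_fmap_iff hij hσ
  refine ⟨Set.ext hset, Finset.card_eq_three.2
    ⟨bar π ((finRotate (n + 1)).symm i.castSucc), bar π i.castSucc, bar π j.castSucc, ?_, ?_, ?_,
    Finset.ext fun k => by
      simpa only [Finset.mem_filter, Finset.mem_univ, true_and, Finset.mem_insert,
        Finset.mem_singleton] using hset k⟩⟩ <;>
  · have := j.2
    have hij' : (i : ℕ) < j := hij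
    simp only [ne_eq, EmbeddingLike.apply_eq_iff_eq, Equiv.symm_apply_eq]
    simp only [Fin.ext_iff, val_finRotate, Fin.val_castSucc]
    grind
end

section
/- For any two permutations π, σ ∈ S_n, the Ulam distance satisfies d_U(π,σ) ≥ (1/3)·d_H(f(π̄), f(σ̄)); equivalently d_H(f(π̄), f(σ̄)) ≤ 3·d_U(π,σ). -/
open scoped Classical

namespace UlamHamming

variable {α : Type*}

/-- One translocation between two distinct valid positions. -/
def Step (l l' : List α) : Prop :=
  ∃ i j, i < l.length ∧ j < l.length ∧ i ≠ j ∧ l' = translocate l i j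

theorem translocate_eq {l : List α} {i : ℕ} (hi : i < l.length) (j : ℕ) :
    translocate l i j = (l.eraseIdx i).insertIdx j l[i] := by
  simp [translocate, List.getElem?_eq_getElem hi]

theorem translocate_cons (a : α) (l : List α) (i j : ℕ) :
    translocate (a :: l) (i + 1) (j + 1) = a :: translocate l i j := by
  unfold translocate
  rw [List.getElem?_cons_succ]
  cases l[i]? <;> simp

theorem Step.cons {l l' : List α} (a : α) (h : Step l l') : Step (a :: l) (a :: l') := by
  obtain ⟨i, j, hi, hj, hij, rfl⟩ := h
  exact ⟨i + 1, j + 1, by simpa, by simpa, by simpa, (translocate_cons a l i j).symm⟩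

theorem Step.perm {l l' : List α} (h : Step l l') : l'.Perm l := by
  obtain ⟨i, j, hi, hj, -, rfl⟩ := h
  rw [translocate_eq hi]
  refine (List.perm_insertIdx _ _ ?_).trans (List.getElem_cons_eraseIdx_perm hi)
  rw [List.length_eraseIdx_of_lt hi]
  omega

theorem reflTransGen_step_of_perm {l l' : List α} (h : l.Perm l') :
    Relation.ReflTransGen Step l l' := by
  induction h with
  | nil => exact .refl
  | cons a _ ih => exact ih.lift (a :: ·) fun _ _ => Step.cons a
  | swap a b l => exact .single ⟨0, 1, by simp, by simp, by simp, by simp [translocate]⟩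
  | trans _ _ ih₁ ih₂ => exact ih₁.trans ih₂

theorem exists_chain_of_reflTransGen {r : α → α → Prop} {x y : α}
    (h : Relation.ReflTransGen r x y) :
    ∃ (m : ℕ) (g : ℕ → α), g 0 = x ∧ g m = y ∧ ∀ k < m, r (g k) (g (k + 1)) := by
  induction h using Relation.ReflTransGen.head_induction_on with
  | refl => exact ⟨0, fun _ => y, rfl, rfl, by simp⟩
  | @head a c hac _ ih =>
    obtain ⟨m, g, h0, hm, hg⟩ := ih
    refine ⟨m + 1, fun k => Nat.casesOn k a g, rfl, hm, ?_⟩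
    rintro (_ | k) hk
    · simpa [h0] using hac
    · exact hg k (by omega)

theorem ulamDist_spec {l l' : List α} (h : l.Perm l') :
    ∃ g : ℕ → List α, g 0 = l ∧ g (ulamDist l l') = l' ∧
      ∀ k < ulamDist l l', Step (g k) (g (k + 1)) :=
  Nat.sInf_mem (s := {m | ∃ g : ℕ → List α, g 0 = l ∧ g m = l' ∧ ∀ k < m, Step (g k) (g (k + 1))})
    (exists_chain_of_reflTransGen (reflTransGen_step_of_perm h))

variable [DecidableEq α]

theorem formPerm_cons_cons_eq_mul_swap {p a : α} {l : List α} (h : (p :: a :: l).Nodup) :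
    (p :: a :: l).formPerm = (p :: l).formPerm * Equiv.swap p a := by
  cases l with
  | nil => simp
  | cons b l =>
    simp only [List.formPerm_cons_cons]
    simp only [List.nodup_cons, List.mem_cons, not_or] at h
    have hp : (b :: l).formPerm p = p := List.formPerm_apply_of_notMem (by simp [h])
    have ha : (b :: l).formPerm a = a := List.formPerm_apply_of_notMem (by simp [h])
    rw [mul_assoc (Equiv.swap p b), Equiv.mul_swap_eq_swap_mul _ p a, hp, ha, ← mul_assoc,
      ← mul_assoc, Equiv.mul_swap_eq_swap_mul _ a b, Equiv.swap_apply_right,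
      Equiv.swap_apply_of_ne_of_ne (Ne.symm h.1.2.1) (Ne.symm h.2.1.1)]

theorem exists_formPerm_insertIdx {z a : α} {l : List α} {j : ℕ} (hj : j ≤ l.length)
    (h : (z :: a :: l).Nodup) :
    ∃ p, (z :: l.insertIdx j a).formPerm = (z :: l).formPerm * Equiv.swap p a := by
  have hperm : (z :: l.insertIdx j a).Perm (z :: a :: l) := (List.perm_insertIdx a l hj).cons z
  obtain ⟨l₁, l₂, hl, -, hins⟩ := List.exists_of_modifyTailIdx (List.cons a) hj
  rw [← List.insertIdx] at hins
  obtain ⟨u, p, hu⟩ := (List.eq_nil_or_concat (z :: l₁)).resolve_left (by simp)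
  rw [List.concat_eq_append] at hu
  have hzl : z :: l = u ++ p :: l₂ := by
    rw [List.append_cons, ← hu, hl, List.cons_append]
  have hzins : z :: l.insertIdx j a = u ++ p :: a :: l₂ := by
    rw [List.append_cons, ← hu, hins, List.cons_append]
  have hn := hperm.nodup_iff.2 h
  rw [hzins] at hn ⊢
  have hr := List.isRotated_append (l := u) (l' := p :: a :: l₂)
  have hr' := List.isRotated_append (l := u) (l' := p :: l₂)
  refine ⟨p, ?_⟩
  rw [hzl, List.formPerm_eq_of_isRotated hn hr, List.formPerm_eq_of_isRotated ?_ hr']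
  · exact formPerm_cons_cons_eq_mul_swap (hr.nodup_iff.1 hn)
  · rw [← hzl]
    exact h.sublist (by simp)

theorem Step.exists_formPerm {z : α} {l l' : List α} (h : Step l l') (hl : (z :: l).Nodup) :
    ∃ p q a, (z :: l').formPerm = (z :: l).formPerm * Equiv.swap p a * Equiv.swap q a := by
  obtain ⟨i, j, hi, hj, -, rfl⟩ := h
  have hn : (z :: l[i] :: l.eraseIdx i).Nodup :=
    ((List.getElem_cons_eraseIdx_perm hi).cons z).nodup_iff.2 hl
  have hlen : (l.eraseIdx i).length = l.length - 1 := List.length_eraseIdx_of_lt hi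
  obtain ⟨p, hp⟩ := exists_formPerm_insertIdx (j := i) (by omega) hn
  obtain ⟨q, hq⟩ := exists_formPerm_insertIdx (j := j) (by omega) hn
  rw [List.insertIdx_eraseIdx_getElem hi] at hp
  refine ⟨p, q, l[i], ?_⟩
  rw [translocate_eq hi, hq, hp, mul_assoc _ (Equiv.swap p l[i]) (Equiv.swap p l[i]),
    Equiv.swap_mul_self, mul_one]

theorem exists_finset_of_chain {z : α} {g : ℕ → List α} (hz : (z :: g 0).Nodup) :
    ∀ m, (∀ k < m, Step (g k) (g (k + 1))) → (z :: g m).Nodup ∧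
      ∃ s : Finset α, s.card ≤ 3 * m ∧
        ∀ x ∉ s, (z :: g 0).formPerm x = (z :: g m).formPerm x
  | 0, _ => ⟨hz, ∅, by simp⟩
  | m + 1, h => by
    obtain ⟨hn, s, hs, hx⟩ := exists_finset_of_chain hz m fun k hk => h k (by omega)
    have hstep := h m (by omega)
    refine ⟨(hstep.perm.cons z).nodup_iff.2 hn, ?_⟩
    obtain ⟨p, q, a, e⟩ := hstep.exists_formPerm hn
    refine ⟨s ∪ {p, q, a}, ?_, fun x hxs => ?_⟩
    · have := Finset.card_union_le s {p, q, a}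
      have := Finset.card_le_three (a := p) (b := q) (c := a)
      omega
    · simp only [Finset.mem_union, Finset.mem_insert, Finset.mem_singleton, not_or] at hxs
      obtain ⟨h1, h2, h3, h4⟩ := hxs
      rw [hx x h1, e]
      simp [Equiv.swap_apply_of_ne_of_ne, *]

theorem seqOf_perm {n : ℕ} (π σ : Equiv.Perm (Fin n)) : (seqOf π).Perm (seqOf σ) := by
  have h := Equiv.Perm.ofFn_comp_perm (σ⁻¹ * π) fun i => (σ i : ℕ) + 1
  simpa [Function.comp_def, seqOf] using h

theorem seqOf_append {n : ℕ} (π : Equiv.Perm (Fin n)) :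
    seqOf π ++ [n + 1] = List.ofFn fun i => (bar π i : ℕ) + 1 := by
  rw [List.ofFn_succ', List.concat_eq_append]
  simp [seqOf, bar]

theorem nodup_cons_seqOf {n : ℕ} (π : Equiv.Perm (Fin n)) : ((n + 1) :: seqOf π).Nodup := by
  rw [← (List.perm_append_singleton _ _).nodup_iff, seqOf_append, List.nodup_ofFn]
  intro i j h
  simpa [Fin.val_inj] using h

theorem formPerm_cons_seqOf {n : ℕ} (π : Equiv.Perm (Fin n)) (i : Fin (n + 1)) :
    ((n + 1) :: seqOf π).formPerm (i + 1) = (fmap π i : ℕ) + 1 := by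
  have hr : ((n + 1) :: seqOf π) ~r (seqOf π ++ [n + 1]) := ⟨1, by simp⟩
  rw [List.formPerm_eq_of_isRotated (nodup_cons_seqOf π) hr]
  have hn := hr.nodup_iff.1 (nodup_cons_seqOf π)
  rw [seqOf_append] at hn ⊢
  obtain ⟨k, rfl⟩ := (bar π).surjective i
  have hk := List.formPerm_apply_getElem _ hn k (by simp [k.is_le])
  simp only [List.getElem_ofFn, List.length_ofFn] at hk
  rw [hk]
  have hrot : (⟨(k + 1) % (n + 1), Nat.mod_lt _ n.succ_pos⟩ : Fin (n + 1)) = k + 1 := by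
    simp [Fin.ext_iff, Fin.val_add]
  simp [fmap, hrot]

end UlamHamming

/-- `d_U(π,σ) ≥ (1/3)·d_H(f(π̄), f(σ̄))`, equivalently
`d_H(f(π̄), f(σ̄)) ≤ 3·d_U(π,σ)`. -/
theorem stmt10 (n : ℕ) (π σ : Equiv.Perm (Fin n)) :
    dH (fmap π) (fmap σ) ≤ 3 * dU π σ := by
  obtain ⟨g, h0, hm, hg⟩ := UlamHamming.ulamDist_spec (UlamHamming.seqOf_perm π σ)
  obtain ⟨-, s, hs, hx⟩ :=
    UlamHamming.exists_finset_of_chain (z := n + 1) (h0 ▸ UlamHamming.nodup_cons_seqOf π) _ hg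
  rw [h0, hm] at hx
  refine le_trans (Finset.card_le_card_of_injOn (fun i => (i : ℕ) + 1) ?_ ?_) hs
  · intro i hi
    by_contra his
    have := hx _ his
    rw [UlamHamming.formPerm_cons_seqOf, UlamHamming.formPerm_cons_seqOf] at this
    simp [Fin.val_inj] at this hi
    exact hi this
  · intro i _ j _ h
    simpa [Fin.val_inj] using h
end
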